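/- Let α ≥ 0 be an admissible exponent of A with associated sequence (M_n), and suppose G_α is invertible on c00(α) with c_α := ‖G_α^{−1}‖ > 0. Then ‖A(m,n)‖ ≤ [c_α(e^α − 1) + 1] M_n for all m ≥ n in ℕ. -/

import Mathlib

open Filter Topology

variable {E : Type*} [NormedAddCommGroup E] [NormedSpace ℝ E] [CompleteSpace E]

/-- `evol A n m` is the evolution operator `A(m,n) = A_{m-1} ∘ ⋯ ∘ A_n`
(the identity if `m ≤ n`). -/
def evol (A : ℕ → E →L[ℝ] E) (n : ℕ) : ℕ → E →L[ℝ] E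
  | 0 => 1
  | m + 1 => if n ≤ m then A m * evol A n m else 1

/-- `α` is an admissible exponent for `A`: there is a positive sequence `M` with
`‖A(m,n)‖ ≤ M n * e^{α (m - n)}` for all `m ≥ n`. -/
def IsAdmissible (A : ℕ → E →L[ℝ] E) (α : ℝ) : Prop :=
  ∃ M : ℕ → ℝ, (∀ n, 0 < M n) ∧
    ∀ m n : ℕ, n ≤ m → ‖evol A n m‖ ≤ M n * Real.exp (α * ((m : ℝ) - (n : ℝ)))

/-- The norm `‖x‖_{n,α} = sup_{m ≥ n} e^{-α(m-n)} ‖A(m,n) x‖`. -/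
noncomputable def nnorm (A : ℕ → E →L[ℝ] E) (α : ℝ) (n : ℕ) (x : E) : ℝ :=
  ⨆ m : Set.Ici n, Real.exp (-α * (((m : ℕ) : ℝ) - (n : ℝ))) * ‖evol A n (m : ℕ) x‖

/-- Membership in `c00(α)`: `u 0 = 0` and `‖u n‖_{n,α} → 0`. -/
def MemC00 (A : ℕ → E →L[ℝ] E) (α : ℝ) (u : ℕ → E) : Prop :=
  u 0 = 0 ∧ Tendsto (fun n => nnorm A α n (u n)) atTop (𝓝 0)

/-- The norm `‖u‖_α = sup_n ‖u n‖_{n,α}` on `c00(α)`. -/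
noncomputable def cnorm (A : ℕ → E →L[ℝ] E) (α : ℝ) (u : ℕ → E) : ℝ :=
  ⨆ n, nnorm A α n (u n)

/-- The evolution map `T`: `(Tu)_0 = 0`, `(Tu)_{n+1} = A_n u_n`. -/
def Tmap (A : ℕ → E →L[ℝ] E) (u : ℕ → E) : ℕ → E
  | 0 => 0
  | m + 1 => A m (u m)

/-- `G = T - Id`. -/
def Gmap (A : ℕ → E →L[ℝ] E) (u : ℕ → E) : ℕ → E :=
  fun n => Tmap A u n - u n

theorem evol_self (A : ℕ → E →L[ℝ] E) (n : ℕ) : evol A n n = 1 := by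
  cases n <;> simp [evol]

theorem evol_succ (A : ℕ → E →L[ℝ] E) {n m : ℕ} (h : n ≤ m) (x : E) :
    evol A n (m + 1) x = A m (evol A n m x) := by
  simp [evol, h]

theorem evol_comp (A : ℕ → E →L[ℝ] E) {n k m : ℕ} (hnk : n ≤ k) (hkm : k ≤ m) (x : E) :
    evol A k m (evol A n k x) = evol A n m x := by
  induction m, hkm using Nat.le_induction with
  | base => simp [evol_self]
  | succ m hkm ih => rw [evol_succ A hkm, evol_succ A (hnk.trans hkm), ih]

theorem nnorm_zero (A : ℕ → E →L[ℝ] E) (α : ℝ) (n : ℕ) : nnorm A α n 0 = 0 := by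
  simp [nnorm]

/-- The weighted orbit is controlled by the exponential bound. -/
theorem exp_mul_norm_evol_le {A : ℕ → E →L[ℝ] E} {α C : ℝ} {n m : ℕ}
    (h : ‖evol A n m‖ ≤ C * Real.exp (α * ((m : ℝ) - (n : ℝ)))) (x : E) :
    Real.exp (-α * ((m : ℝ) - (n : ℝ))) * ‖evol A n m x‖ ≤ C * ‖x‖ := by
  calc Real.exp (-α * ((m : ℝ) - (n : ℝ))) * ‖evol A n m x‖
      ≤ Real.exp (-α * ((m : ℝ) - (n : ℝ))) *
          (C * Real.exp (α * ((m : ℝ) - (n : ℝ))) * ‖x‖) := by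
        gcongr
        exact (evol A n m).le_of_opNorm_le h x
    _ = C * ‖x‖ := by
        rw [neg_mul, Real.exp_neg]
        field_simp

theorem norm_le_nnorm {A : ℕ → E →L[ℝ] E} {α C : ℝ} {n : ℕ}
    (h : ∀ m, n ≤ m → ‖evol A n m‖ ≤ C * Real.exp (α * ((m : ℝ) - (n : ℝ)))) (x : E) :
    ‖x‖ ≤ nnorm A α n x := by
  have hb : BddAbove (Set.range fun m : Set.Ici n =>
      Real.exp (-α * (((m : ℕ) : ℝ) - (n : ℝ))) * ‖evol A n (m : ℕ) x‖) := by
    refine ⟨C * ‖x‖, ?_⟩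
    rintro _ ⟨m, rfl⟩
    exact exp_mul_norm_evol_le (h m m.2) x
  simpa [evol_self, nnorm] using le_ciSup hb ⟨n, Set.self_mem_Ici⟩

theorem MemC00.nnorm_le_cnorm {A : ℕ → E →L[ℝ] E} {α : ℝ} {u : ℕ → E} (hu : MemC00 A α u)
    (n : ℕ) : nnorm A α n (u n) ≤ cnorm A α u :=
  le_ciSup hu.2.bddAbove_range n

/-- The orbit of `x` from time `n`, damped by `e^{-α(k-n)}` and restricted to `n < k ≤ m`. -/
noncomputable def dampedOrbit (A : ℕ → E →L[ℝ] E) (α : ℝ) (n m : ℕ) (x : E) (k : ℕ) : E :=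
  if n < k ∧ k ≤ m then Real.exp (-α * ((k : ℝ) - (n : ℝ))) • evol A n k x else 0

theorem memC00_dampedOrbit (A : ℕ → E →L[ℝ] E) (α : ℝ) (n m : ℕ) (x : E) :
    MemC00 A α (dampedOrbit A α n m x) := by
  refine ⟨by simp [dampedOrbit], tendsto_const_nhds.congr' ?_⟩
  filter_upwards [eventually_gt_atTop m] with k hk
  rw [dampedOrbit, if_neg (by omega), nnorm_zero]

theorem cnorm_dampedOrbit_le {A : ℕ → E →L[ℝ] E} {α C : ℝ} (hC : 0 ≤ C) {n : ℕ}
    (h : ∀ m, n ≤ m → ‖evol A n m‖ ≤ C * Real.exp (α * ((m : ℝ) - (n : ℝ)))) (m : ℕ) (x : E) :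
    cnorm A α (dampedOrbit A α n m x) ≤ C * ‖x‖ := by
  refine ciSup_le fun k => ?_
  rw [dampedOrbit]
  split_ifs with hk
  · have : Nonempty (Set.Ici k) := ⟨⟨k, Set.self_mem_Ici⟩⟩
    refine ciSup_le fun l => ?_
    have hkl : k ≤ (l : ℕ) := l.2
    rw [map_smul, evol_comp A hk.1.le hkl, norm_smul, Real.norm_of_nonneg (Real.exp_nonneg _),
      ← mul_assoc, ← Real.exp_add, ← mul_add, sub_add_sub_cancel]
    exact exp_mul_norm_evol_le (h l (hk.1.le.trans hkl)) x
  · rw [nnorm_zero]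
    positivity

theorem eq_of_Gmap_eq_dampedOrbit {A : ℕ → E →L[ℝ] E} {α : ℝ} {n m : ℕ} {x : E} {u : ℕ → E}
    (hu0 : u 0 = 0) (hu : Gmap A u = dampedOrbit A α n m x) {k : ℕ} (hk : k ≤ m) :
    u k = -((∑ j ∈ Finset.range (k - n), Real.exp (-α * ((j : ℝ) + 1))) • evol A n k x) := by
  induction k with
  | zero => simp [hu0]
  | succ k ih =>
    have hG : A k (u k) - u (k + 1) = dampedOrbit A α n m x (k + 1) := congrFun hu (k + 1)
    rw [← sub_sub_cancel (A k (u k)) (u (k + 1)), hG, ih (by omega), dampedOrbit]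
    split_ifs with hnk
    · have hle : n ≤ k := by omega
      rw [Nat.sub_add_comm hle, Finset.sum_range_succ, evol_succ A hle, map_neg, map_smul,
        Nat.cast_sub hle, add_smul, neg_add, sub_eq_add_neg]
      congr 4
      push_cast
      ring
    · simp [show k - n = 0 by omega, show k + 1 - n = 0 by omega]

theorem exp_sub_one_mul_sum_exp_neg (α : ℝ) (p : ℕ) :
    (Real.exp α - 1) * ∑ j ∈ Finset.range p, Real.exp (-α * ((j : ℝ) + 1)) =
      1 - Real.exp (-α * p) := by
  induction p with
  | zero => simp
  | succ p ih =>
    rw [Finset.sum_range_succ, mul_add, ih, sub_mul, ← Real.exp_add,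
      show α + -α * ((p : ℝ) + 1) = -α * p by ring]
    push_cast
    ring

/-- If `α ≥ 0` is admissible with sequence `(M_n)` and `G_α` is invertible
on `c00(α)` with `c_α = ‖G_α⁻¹‖ > 0`, then `‖A(m,n)‖ ≤ (c_α(e^α - 1) + 1) M_n`. -/
theorem stmt4 (A : ℕ → E →L[ℝ] E) (α : ℝ) (hα0 : 0 ≤ α) (M : ℕ → ℝ)
    (hM : ∀ n, 0 < M n)
    (hbd : ∀ m n : ℕ, n ≤ m → ‖evol A n m‖ ≤ M n * Real.exp (α * ((m : ℝ) - (n : ℝ))))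
    (c : ℝ) (hc : 0 < c)
    (hsurj : ∀ v, MemC00 A α v → ∃ u, MemC00 A α u ∧ Gmap A u = v)
    (hinv : ∀ u, MemC00 A α u → cnorm A α u ≤ c * cnorm A α (Gmap A u)) :
    ∀ m n : ℕ, n ≤ m → ‖evol A n m‖ ≤ (c * (Real.exp α - 1) + 1) * M n := by
  intro m n hnm
  have hα1 : 0 ≤ Real.exp α - 1 := by linarith [Real.one_le_exp hα0]
  refine ContinuousLinearMap.opNorm_le_bound _
    (mul_nonneg (by positivity) (hM n).le) fun x => ?_
  obtain ⟨u, hu, hGu⟩ := hsurj _ (memC00_dampedOrbit A α n m x)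
  have hn := fun k => hbd k n
  set s := ∑ j ∈ Finset.range (m - n), Real.exp (-α * ((j : ℝ) + 1)) with hs
  have hs0 : 0 ≤ s := Finset.sum_nonneg fun _ _ => (Real.exp_pos _).le
  have hsum : s * ‖evol A n m x‖ ≤ c * (M n * ‖x‖) := calc
    s * ‖evol A n m x‖ = ‖u m‖ := by
      rw [eq_of_Gmap_eq_dampedOrbit hu.1 hGu le_rfl, norm_neg, norm_smul, ← hs,
        Real.norm_of_nonneg hs0]
    _ ≤ nnorm A α m (u m) := norm_le_nnorm (fun k => hbd k m) _
    _ ≤ cnorm A α u := hu.nnorm_le_cnorm m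
    _ ≤ c * cnorm A α (Gmap A u) := hinv u hu
    _ ≤ c * (M n * ‖x‖) := by
      rw [hGu]
      gcongr
      exact cnorm_dampedOrbit_le (hM n).le hn m x
  have hgeom := exp_sub_one_mul_sum_exp_neg α (m - n)
  rw [← hs, Nat.cast_sub hnm] at hgeom
  calc ‖evol A n m x‖
      = (Real.exp α - 1) * (s * ‖evol A n m x‖) +
          Real.exp (-α * ((m : ℝ) - (n : ℝ))) * ‖evol A n m x‖ := by
        rw [← mul_assoc, hgeom]
        ring
    _ ≤ (Real.exp α - 1) * (c * (M n * ‖x‖)) + M n * ‖x‖ := by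
        exact add_le_add (mul_le_mul_of_nonneg_left hsum hα1)
          (exp_mul_norm_evol_le (hn m hnm) x)
    _ = (c * (Real.exp α - 1) + 1) * M n * ‖x‖ := by ring
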